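/- arXiv:1703.06392 — 2 statements merged into one kernel-verified Lean document; each statement's English description precedes it below -/
import Mathlib

section
/- Let B = (𝓑_i)_{i∈S} be a collection of finite nonempty subsets of ℤ^n such that def(S) = d(B) < 0, and let J ⊆ S be the unique essential subset of B. Then for every i ∈ J, both the defect of the full collection with i removed and its minimal defect increase by exactly one: def(S ∖ {i}) = d(B restricted to S ∖ {i}) = d(B) + 1, where d(B restricted to S ∖ {i}) denotes the minimal defect of the collection (𝓑_j)_{j∈S∖{i}}. -/
noncomputable section

/-- `L(J)`: the `ℝ`-linear span of all differences `a - b` with `a, b ∈ B i` for some `i ∈ J`. -/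
def colSpan {ι V : Type*} [AddCommGroup V] [Module ℝ V]
    (B : ι → Set V) (J : Set ι) : Submodule ℝ V :=
  Submodule.span ℝ {v | ∃ i ∈ J, ∃ a ∈ B i, ∃ b ∈ B i, v = a - b}

/-- The defect `def(J) = dim L(J) - |J|`. -/
def colDefect {ι V : Type*} [AddCommGroup V] [Module ℝ V]
    (B : ι → Set V) (J : Finset ι) : ℤ :=
  (Module.finrank ℝ (colSpan B (J : Set ι)) : ℤ) - (J.card : ℤ)

/-- The minimal defect `min_{J ⊆ S} def(J)` over all subsets of `S` (including `∅`). -/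
def colMinDefectOn {ι V : Type*} [AddCommGroup V] [Module ℝ V]
    (B : ι → Set V) (S : Finset ι) : ℤ :=
  S.powerset.inf' ⟨∅, Finset.empty_mem_powerset S⟩ (fun J => colDefect B J)

/-- A finite subset of `ℤ^n` viewed inside `ℝ^n`. -/
def realize {n : ℕ} (A : Finset (Fin n → ℤ)) : Set (Fin n → ℝ) :=
  (fun a : Fin n → ℤ => fun j => (a j : ℝ)) '' (A : Set (Fin n → ℤ))

section Defect

variable {ι V : Type*} [AddCommGroup V] [Module ℝ V]

theorem colSpan_mono (B : ι → Set V) {I J : Set ι} (h : I ⊆ J) : colSpan B I ≤ colSpan B J :=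
  Submodule.span_mono fun _ ⟨i, hi, hv⟩ => ⟨i, h hi, hv⟩

theorem colSpan_union (B : ι → Set V) (I J : Set ι) :
    colSpan B (I ∪ J) = colSpan B I ⊔ colSpan B J := by
  refine le_antisymm (Submodule.span_le.mpr ?_)
    (sup_le (colSpan_mono B Set.subset_union_left) (colSpan_mono B Set.subset_union_right))
  rintro v ⟨i, hi | hi, hv⟩
  · exact Submodule.mem_sup_left (Submodule.subset_span ⟨i, hi, hv⟩)
  · exact Submodule.mem_sup_right (Submodule.subset_span ⟨i, hi, hv⟩)

/-- The defect is submodular. -/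
theorem colDefect_union_add_inter_le [FiniteDimensional ℝ V] [DecidableEq ι] (B : ι → Set V)
    (I J : Finset ι) :
    colDefect B (I ∪ J) + colDefect B (I ∩ J) ≤ colDefect B I + colDefect B J := by
  have hdim := Submodule.finrank_sup_add_finrank_inf_eq
    (colSpan B (I : Set ι)) (colSpan B (J : Set ι))
  have hinter : Module.finrank ℝ (colSpan B ((I : Set ι) ∩ J)) ≤
      Module.finrank ℝ (colSpan B (I : Set ι) ⊓ colSpan B (J : Set ι) : Submodule ℝ V) :=
    Submodule.finrank_mono
      (le_inf (colSpan_mono B Set.inter_subset_left) (colSpan_mono B Set.inter_subset_right))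
  have hcard := Finset.card_union_add_card_inter I J
  unfold colDefect
  rw [Finset.coe_union, Finset.coe_inter, colSpan_union]
  lia

/-- Removing one member increases the defect by at most one. -/
theorem colDefect_erase_le [FiniteDimensional ℝ V] [DecidableEq ι] (B : ι → Set V)
    {S : Finset ι} {i : ι} (hi : i ∈ S) : colDefect B (S.erase i) ≤ colDefect B S + 1 := by
  have hdim : Module.finrank ℝ (colSpan B (S.erase i : Set ι)) ≤
      Module.finrank ℝ (colSpan B (S : Set ι)) :=
    Submodule.finrank_mono (colSpan_mono B (Finset.coe_subset.mpr (S.erase_subset i)))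
  have hcard := Finset.card_erase_add_one hi
  unfold colDefect
  lia

theorem colMinDefectOn_le (B : ι → Set V) {I S : Finset ι} (h : I ⊆ S) :
    colMinDefectOn B S ≤ colDefect B I :=
  Finset.inf'_le (fun J => colDefect B J) (Finset.mem_powerset.mpr h)

/-- A subcollection missing a member of an essential subset does not have minimal defect. -/
theorem colMinDefectOn_lt_colDefect [FiniteDimensional ℝ V] [DecidableEq ι] (B : ι → Set V)
    {S I J : Finset ι} (hJS : J ⊆ S) (hJ : colDefect B J = colMinDefectOn B S)
    (hJmin : ∀ K : Finset ι, K ⊂ J → colMinDefectOn B S < colDefect B K)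
    (hIS : I ⊆ S) {i : ι} (hiJ : i ∈ J) (hiI : i ∉ I) :
    colMinDefectOn B S < colDefect B I := by
  have hinter := hJmin (J ∩ I) <| Finset.ssubset_iff_subset_ne.mpr
    ⟨Finset.inter_subset_left, fun h => hiI (Finset.inter_eq_left.mp h hiJ)⟩
  have hunion := colMinDefectOn_le B (Finset.union_subset hJS hIS)
  have hsub := colDefect_union_add_inter_le B J I
  lia

end Defect

/-- If `def(S) = d(B) < 0` and `J` is the unique essential subset, then for
every `i ∈ J` one has `def(S ∖ {i}) = d(B restricted to S ∖ {i}) = d(B) + 1`. -/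
theorem defect_erase_essential {n : ℕ} (hn : 1 ≤ n) {ι : Type*} [Fintype ι] [DecidableEq ι]
    (B : ι → Finset (Fin n → ℤ)) (hB : ∀ i, (B i).Nonempty)
    (hneg : colMinDefectOn (fun i => realize (B i)) Finset.univ < 0)
    (hfull : colDefect (fun i => realize (B i)) Finset.univ =
      colMinDefectOn (fun i => realize (B i)) Finset.univ)
    (J : Finset ι)
    (hJ : colDefect (fun i => realize (B i)) J =
      colMinDefectOn (fun i => realize (B i)) Finset.univ)
    (hJmin : ∀ I : Finset ι, I ⊂ J →
      colMinDefectOn (fun i => realize (B i)) Finset.univ <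
        colDefect (fun i => realize (B i)) I)
    (i : ι) (hi : i ∈ J) :
    colDefect (fun j => realize (B j)) (Finset.univ.erase i) =
      colMinDefectOn (fun j => realize (B j)) Finset.univ + 1 ∧
    colMinDefectOn (fun j => realize (B j)) (Finset.univ.erase i) =
      colMinDefectOn (fun j => realize (B j)) Finset.univ + 1 := by
  have hlt : colMinDefectOn (fun j => realize (B j)) Finset.univ <
      colMinDefectOn (fun j => realize (B j)) (Finset.univ.erase i) :=
    (Finset.lt_inf'_iff _).mpr fun I hI =>
      colMinDefectOn_lt_colDefect _ J.subset_univ hJ hJmin I.subset_univ hi fun h =>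
        Finset.notMem_erase i _ (Finset.mem_powerset.mp hI h)
  have hle := colMinDefectOn_le (fun j => realize (B j))
    (Finset.Subset.refl (Finset.univ.erase i))
  have herase := colDefect_erase_le (fun j => realize (B j)) (Finset.mem_univ i)
  constructor <;> lia
end
end

section
/- Let d ≥ 1 and let A = (𝒜_1, …, 𝒜_{n+d}) be a collection of n+d finite nonempty subsets of ℤ^n, indexed by S = {1, …, n+d}, such that G(A) = ℤ^n (equivalently, ind(A) = 1) and A is essential of defect −d, i.e., −d = d(A) = def(S) and def(J) > −d for every proper subset J ⊊ S. Then there exists a polynomial function F on Ω_A that does not vanish identically on the set of consistency X_A, such that for every f ∈ X_A with F(f) ≠ 0, the zero set Y_f ⊆ (ℂ*)^n is a single point. -/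
noncomputable section

/-- The monomial `p^a = ∏_j p_j^{a_j}` as an element of `ℂˣ`. -/
def mon {n : ℕ} (p : Fin n → ℂˣ) (a : Fin n → ℤ) : ℂˣ :=
  ∏ j, p j ^ a j

/-- Evaluation of a Laurent polynomial `f` with support in `A` at `p ∈ (ℂ*)^n`:
`f(p) = ∑_{a ∈ A} f_a · p^a`. -/
def evalL {n : ℕ} {A : Finset (Fin n → ℤ)} (f : {x // x ∈ A} → ℂ) (p : Fin n → ℂˣ) : ℂ :=
  ∑ a : {x // x ∈ A}, f a * (mon p a.1 : ℂ)


namespace MvPolynomial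

variable {R σ τ : Type*}

theorem pderiv_aeval [CommSemiring R] [Fintype τ] (x : τ → MvPolynomial σ R) (P : MvPolynomial τ R)
    (t : σ) : pderiv t (aeval x P) = ∑ v, aeval x (pderiv v P) * pderiv t (x v) := by
  classical
  induction P using MvPolynomial.induction_on with
  | C a => simp
  | add p q hp hq => simp only [map_add, hp, hq, add_mul, Finset.sum_add_distrib]
  | mul_X p w hp =>
    simp only [map_mul, aeval_X, pderiv_mul, hp, map_add, pderiv_X, add_mul, Finset.sum_add_distrib,
      Finset.sum_mul, Pi.single_apply, mul_ite, mul_one, mul_zero, apply_ite (aeval x), map_zero,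
      ite_mul, zero_mul, map_mul]
    congr 1
    · exact Finset.sum_congr rfl fun _ _ => by ring
    · simp

theorem totalDegree_pderiv_lt [CommSemiring R] {s : σ} {P : MvPolynomial σ R}
    (h : pderiv s P ≠ 0) : (pderiv s P).totalDegree < P.totalDegree := by
  classical
  have key : ∀ m ∈ (pderiv s P).support, (m.sum fun _ e => e) + 1 ≤ P.totalDegree := by
    intro m hm
    rw [mem_support_iff, coeff_pderiv] at hm
    have h2 := le_totalDegree (mem_support_iff.2 (left_ne_zero_of_mul hm))
    rwa [Finsupp.sum_add_index' (by simp) (by simp), Finsupp.sum_single_index rfl] at h2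
  obtain ⟨m, hm⟩ := Finset.nonempty_iff_ne_empty.2 (mt support_eq_empty.1 h)
  refine (Finset.sup_lt_iff ?_).2 fun m hm => key m hm
  exact lt_of_lt_of_le (Nat.succ_pos _) (key m hm)

theorem eq_C_of_pderiv_eq_zero [CommRing R] [IsDomain R] [CharZero R] {P : MvPolynomial σ R}
    (h : ∀ s, pderiv s P = 0) : P = C (coeff 0 P) := by
  classical
  ext m
  rw [coeff_C]
  split_ifs with hm
  · rw [hm]
  · obtain ⟨s, hs⟩ := Finsupp.ne_iff.1 (Ne.symm hm)
    have h1 := coeff_pderiv (i := s) P (m - Finsupp.single s 1)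
    rw [h s, coeff_zero, tsub_add_cancel_of_le] at h1
    · exact (mul_eq_zero.1 h1.symm).resolve_right (Nat.cast_add_one_ne_zero _)
    · rw [Finsupp.single_le_iff]; exact Nat.one_le_iff_ne_zero.2 hs

/-- A family of `#σ + 1` polynomials in the variables `σ`, of which `#σ` have a nondegenerate
Jacobian matrix at some point, satisfies an algebraic relation whose derivative in the
remaining element does not vanish along the family. -/
theorem exists_relation_pderiv_none_ne_zero {K : Type*} [Field K] [CharZero K] {σ : Type} [Fintype σ]
    
    (w : Option σ → MvPolynomial σ K) (y : σ → K)
    (hJ : ∀ u : σ → K, (∀ s, ∑ t, eval y (pderiv t (w (some s))) * u t = 0) → u = 0) :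
    ∃ P : MvPolynomial (Option σ) K, aeval w P = 0 ∧ aeval w (pderiv none P) ≠ 0 := by
  classical
  have hdep : ¬ AlgebraicIndependent K w := by
    intro h
    have h1 := h.lift_cardinalMk_le_trdeg
    rw [MvPolynomial.trdeg_of_isDomain] at h1
    simp only [Cardinal.mk_fintype, Fintype.card_option, Cardinal.lift_natCast, Nat.cast_le] at h1
    omega
  have hex : ∃ P : MvPolynomial (Option σ) K, P ≠ 0 ∧ aeval w P = 0 := by
    rw [algebraicIndependent_iff] at hdep
    push Not at hdep
    obtain ⟨P, h1, h2⟩ := hdep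
    exact ⟨P, h2, h1⟩
  obtain ⟨P, ⟨hP0, hP⟩, hmin⟩ := exists_minimalFor_of_wellFoundedLT _ totalDegree hex
  have hzero : ∀ s, aeval w (pderiv s P) = 0 → pderiv s P = 0 := by
    intro s hs
    by_contra hne
    exact (totalDegree_pderiv_lt hne).not_ge (hmin ⟨hne, hs⟩ (totalDegree_pderiv_lt hne).le)
  refine ⟨P, hP, fun hnone => hP0 ?_⟩
  let M : Matrix σ σ (MvPolynomial σ K) := Matrix.of fun s t => pderiv t (w (some s))
  have hM : M.det ≠ 0 := by
    intro hdet
    have h0 : (M.map (eval y)).det = 0 := by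
      rw [← RingHom.mapMatrix_apply, ← RingHom.map_det, hdet, map_zero]
    obtain ⟨u, hu, hMu⟩ := Matrix.exists_mulVec_eq_zero_iff.2 h0
    exact hu (hJ u fun s => congrFun hMu s)
  have hsome := Matrix.eq_zero_of_vecMul_eq_zero hM
    (v := fun s => aeval w (pderiv (some s) P)) <| by
      ext1 t
      have h1 := pderiv_aeval w P t
      rw [hP, map_zero, Fintype.sum_option, hnone, zero_mul, zero_add] at h1
      exact h1.symm
  have hC : P = C (coeff 0 P) := eq_C_of_pderiv_eq_zero fun s => by
    cases s with
    | none => exact hzero _ hnone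
    | some s => exact hzero _ (congrFun hsome s)
  rw [hC, aeval_C, algebraMap_eq, C_eq_zero] at hP
  rw [hC, hP, C_0]

/-- The derivative of a polynomial at the point `y` in the direction `u`. -/
def dirDeriv [CommRing R] [Fintype σ] (y u : σ → R) : MvPolynomial σ R →ₗ[R] R :=
  ∑ t, u t • (aeval y).toLinearMap ∘ₗ (pderiv t).toLinearMap

section dirDeriv

variable [CommRing R] [Fintype σ] (y u : σ → R)

theorem dirDeriv_apply (p : MvPolynomial σ R) :
    dirDeriv y u p = ∑ t, eval y (pderiv t p) * u t := by
  simp [dirDeriv, aeval_eq_eval, mul_comm]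

theorem dirDeriv_X (s : σ) : dirDeriv y u (X s) = u s := by
  classical
  simp [dirDeriv_apply, pderiv_X, Pi.single_apply, apply_ite (eval y)]

theorem dirDeriv_mul (p q : MvPolynomial σ R) :
    dirDeriv y u (p * q) = dirDeriv y u p * eval y q + eval y p * dirDeriv y u q := by
  simp only [dirDeriv_apply, pderiv_mul, map_add, map_mul, add_mul, Finset.sum_add_distrib,
    Finset.sum_mul, Finset.mul_sum]
  congr 1 <;> exact Finset.sum_congr rfl fun _ _ => by ring

theorem dirDeriv_prod_of_eval_eq_one {ι : Type*} (s : Finset ι) (q : ι → MvPolynomial σ R)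
    (hq : ∀ l ∈ s, eval y (q l) = 1) :
    dirDeriv y u (∏ l ∈ s, q l) = ∑ l ∈ s, dirDeriv y u (q l) := by
  classical
  induction s using Finset.induction_on with
  | empty => simp [dirDeriv_apply]
  | insert a s ha ih =>
    have h1 : eval y (∏ l ∈ s, q l) = 1 := by
      rw [map_prod]
      exact Finset.prod_eq_one fun l hl => hq l (Finset.mem_insert_of_mem hl)
    rw [Finset.prod_insert ha, Finset.sum_insert ha, dirDeriv_mul, h1,
      hq a (Finset.mem_insert_self _ _), ih fun l hl => hq l (Finset.mem_insert_of_mem hl),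
      mul_one, one_mul]

theorem dirDeriv_pow_of_eval_eq_one (q : MvPolynomial σ R) (hq : eval y q = 1) (k : ℕ) :
    dirDeriv y u (q ^ k) = k * dirDeriv y u q := by
  simpa using dirDeriv_prod_of_eval_eq_one y u (Finset.range k) (fun _ => q) fun _ _ => hq

end dirDeriv

end MvPolynomial

theorem exists_transversal_le_finrank_span {K V ι : Type*} [Field K] [AddCommGroup V] [Module K V]
    [FiniteDimensional K V] [DecidableEq ι] (S : Finset ι) (c : ℤ) (B : ι → Finset V)
    (hB : ∀ j, (B j).Nonempty)
    (h : ∀ J ⊆ S, (J.card : ℤ) - c ≤ Module.finrank K (Submodule.span K (⋃ j ∈ J, (B j : Set V)))) :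
    ∃ b : ι → V, (∀ j, b j ∈ B j) ∧
      (S.card : ℤ) - c ≤ Module.finrank K (Submodule.span K (b '' S)) := by
  classical
  induction hN : ∑ j ∈ S, (B j).card using Nat.strong_induction_on generalizing B with
  | _ N ih =>
  by_cases hsing : ∀ j ∈ S, (B j).card ≤ 1
  · choose b hb using hB
    refine ⟨b, hb, (h S subset_rfl).trans ?_⟩
    norm_cast
    refine Submodule.finrank_mono (Submodule.span_mono ?_)
    simp only [Set.iUnion_subset_iff]
    intro j hj x hx
    exact ⟨j, hj, Finset.card_le_one.1 (hsing j hj) _ (hb j) _ hx⟩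
  push Not at hsing
  obtain ⟨i, hi, hcard⟩ := hsing
  obtain ⟨x, hx, y, hy, hxy⟩ := Finset.one_lt_card.1 hcard
  have step : ∀ z ∈ B i, (∀ J ⊆ S, i ∈ J → (J.card : ℤ) - c ≤ Module.finrank K (Submodule.span K
      (⋃ j ∈ J, (Function.update B i ((B i).erase z) j : Set V)))) →
      ∃ b : ι → V, (∀ j, b j ∈ B j) ∧
        (S.card : ℤ) - c ≤ Module.finrank K (Submodule.span K (b '' S)) := by
    intro z hz hJ
    have := ih (∑ j ∈ S, (Function.update B i ((B i).erase z) j).card) ?_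
      (Function.update B i ((B i).erase z)) ?_ ?_ rfl
    · obtain ⟨b, hb, hb'⟩ := this
      refine ⟨b, fun j => ?_, hb'⟩
      have := hb j
      by_cases hji : j = i
      · subst hji
        rw [Function.update_self] at this
        exact Finset.mem_of_mem_erase this
      · rwa [Function.update_of_ne hji] at this
    · rw [← hN]
      refine Finset.sum_lt_sum (fun j _ => ?_) ⟨i, hi, ?_⟩
      · by_cases hji : j = i
        · subst hji
          rw [Function.update_self]
          exact Finset.card_erase_le
        · rw [Function.update_of_ne hji]
      · rw [Function.update_self]
        exact Finset.card_erase_lt_of_mem hz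
    · intro j
      by_cases hji : j = i
      · subst hji
        rw [Function.update_self, ← Finset.card_pos, Finset.card_erase_of_mem hz]
        omega
      · rw [Function.update_of_ne hji]
        exact hB j
    · intro J hJS
      by_cases hiJ : i ∈ J
      · exact hJ J hJS hiJ
      · have : (⋃ j ∈ J, (Function.update B i ((B i).erase z) j : Set V)) = ⋃ j ∈ J, (B j : Set V) :=
          Set.iUnion₂_congr fun j hj => by
            rw [Function.update_of_ne (ne_of_mem_of_not_mem hj hiJ)]
        rw [this]
        exact h J hJS
  by_contra hcon
  have hx' := mt (step x hx) hcon
  have hy' := mt (step y hy) hcon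
  push Not at hx' hy'
  obtain ⟨J, hJS, hiJ, hJ⟩ := hx'
  obtain ⟨L, hLS, hiL, hL⟩ := hy'
  have hsup := Submodule.finrank_sup_add_finrank_inf_eq
    (Submodule.span K (⋃ j ∈ J, (Function.update B i ((B i).erase x) j : Set V)))
    (Submodule.span K (⋃ j ∈ L, (Function.update B i ((B i).erase y) j : Set V)))
  have h1 : Module.finrank K (Submodule.span K (⋃ j ∈ J ∪ L, (B j : Set V))) ≤ Module.finrank K
      (Submodule.span K (⋃ j ∈ J, (Function.update B i ((B i).erase x) j : Set V)) ⊔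
       Submodule.span K (⋃ j ∈ L, (Function.update B i ((B i).erase y) j : Set V)) :
        Submodule K V) := by
    rw [← Submodule.span_union]
    refine Submodule.finrank_mono (Submodule.span_mono ?_)
    simp only [Set.iUnion_subset_iff]
    intro j hj v hv
    by_cases hji : j = i
    · subst hji
      by_cases hvx : v = x
      · refine Or.inr (Set.mem_biUnion hiL ?_)
        rw [Function.update_self]
        exact Finset.mem_erase.2 ⟨hvx ▸ hxy, hv⟩
      · refine Or.inl (Set.mem_biUnion hiJ ?_)
        rw [Function.update_self]
        exact Finset.mem_erase.2 ⟨hvx, hv⟩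
    · rcases Finset.mem_union.1 hj with hj | hj
      · refine Or.inl (Set.mem_biUnion hj ?_)
        rwa [Function.update_of_ne hji]
      · refine Or.inr (Set.mem_biUnion hj ?_)
        rwa [Function.update_of_ne hji]
  have h2 : Module.finrank K (Submodule.span K (⋃ j ∈ (J ∩ L).erase i, (B j : Set V))) ≤
      Module.finrank K
      (Submodule.span K (⋃ j ∈ J, (Function.update B i ((B i).erase x) j : Set V)) ⊓
       Submodule.span K (⋃ j ∈ L, (Function.update B i ((B i).erase y) j : Set V)) :
        Submodule K V) := by
    refine Submodule.finrank_mono (le_inf (Submodule.span_mono ?_) (Submodule.span_mono ?_)) <;>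
    · simp only [Set.iUnion_subset_iff]
      intro j hj v hv
      simp only [Finset.mem_erase, Finset.mem_inter] at hj
      refine Set.mem_biUnion (x := j) (by simp [hj]) ?_
      rwa [Function.update_of_ne hj.1]
  have h3 := h (J ∪ L) (Finset.union_subset hJS hLS)
  have h4 := h ((J ∩ L).erase i)
    ((Finset.erase_subset _ _).trans (Finset.inter_subset_left.trans hJS))
  have h5 := Finset.card_union_add_card_inter J L
  have h6 := Finset.card_erase_add_one (Finset.mem_inter.2 ⟨hiJ, hiL⟩)
  omega

section Laurent

variable {n : ℕ}

theorem mon_sub (p : Fin n → ℂˣ) (a b : Fin n → ℤ) : mon p (a - b) = mon p a / mon p b := by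
  simp only [mon, Pi.sub_apply, zpow_sub, ← div_eq_mul_inv, Finset.prod_div_distrib]

theorem mon_single (p : Fin n → ℂˣ) (l : Fin n) : mon p (Pi.single l 1) = p l := by
  classical
  unfold mon
  rw [Finset.prod_eq_single l]
  · simp
  · intro k _ hk
    simp [hk]
  · simp

/-- A point of the torus is determined by the values of a generating set of characters. -/
theorem eq_of_mon_eq {G : Set (Fin n → ℤ)} (hG : AddSubgroup.closure G = ⊤) {p q : Fin n → ℂˣ}
    (h : ∀ v ∈ G, mon p v = mon q v) : p = q := by
  have key : ∀ v : Fin n → ℤ, mon p v = mon q v := by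
    intro v
    have hv : v ∈ AddSubgroup.closure G := hG ▸ AddSubgroup.mem_top v
    induction hv using AddSubgroup.closure_induction with
    | mem x hx => exact h x hx
    | zero => simp [mon]
    | add x y _ _ hx hy =>
      simp only [mon, Pi.add_apply, zpow_add, Finset.prod_mul_distrib] at hx hy ⊢
      rw [hx, hy]
    | neg x _ hx =>
      simp only [mon, Pi.neg_apply, zpow_neg, Finset.prod_inv_distrib] at hx ⊢
      rw [hx]
  funext l
  rw [← mon_single p l, ← mon_single q l, key]

end Laurent

namespace ConsistentSystem

open MvPolynomial

variable {n m : ℕ}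

/-- The index set of the coefficients of a system with supports `A`. -/
abbrev CoeffIdx (A : Fin m → Finset (Fin n → ℤ)) : Type := (i : Fin m) × {x // x ∈ A i}

variable {A : Fin m → Finset (Fin n → ℤ)}

/-- The parameters of consistent systems: the coordinates of a common zero, and all coefficients
but one distinguished coefficient of each equation. -/
abbrev Param (a₀ : ∀ i, {x // x ∈ A i}) : Type := Fin n ⊕ {v : CoeffIdx A // v.2 ≠ a₀ v.1}

variable (N : ℕ) (a₀ : ∀ i, {x // x ∈ A i})

/-- The monomial with exponent `a + (N, …, N)` in the coordinates of the common zero. -/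
def shiftMon (a : Fin n → ℤ) : MvPolynomial (Param a₀) ℂ :=
  ∏ l, X (Sum.inl l) ^ (a l + N).toNat

/-- The free coefficient at `v`, with the distinguished coefficients set to `0`. -/
def freeCoeff (v : CoeffIdx A) : MvPolynomial (Param a₀) ℂ :=
  if h : v.2 ≠ a₀ v.1 then X (Sum.inr ⟨v, h⟩) else 0

/-- The polynomial parametrization of the consistent systems. -/
def param (v : CoeffIdx A) : MvPolynomial (Param a₀) ℂ :=
  freeCoeff a₀ v * shiftMon N a₀ (a₀ v.1).1 -
    if v.2 = a₀ v.1 then ∑ a, freeCoeff a₀ ⟨v.1, a⟩ * shiftMon N a₀ a.1 else 0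

theorem sum_param_mul_shiftMon (i : Fin m) :
    ∑ a : {x // x ∈ A i}, param N a₀ ⟨i, a⟩ * shiftMon N a₀ a.1 = 0 := by
  simp only [param, sub_mul, Finset.sum_sub_distrib, ite_mul, zero_mul, Finset.sum_ite_eq',
    Finset.mem_univ, if_true]
  rw [Finset.sum_mul, sub_eq_zero]
  exact Finset.sum_congr rfl fun a _ => by ring

variable {N} in
theorem eval_shiftMon {a : Fin n → ℤ} (ha : ∀ l, 0 ≤ a l + N) {p : Fin n → ℂˣ}
    {y : Param a₀ → ℂ} (hy : ∀ l, y (Sum.inl l) = p l) :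
    eval y (shiftMon N a₀ a) = (mon p a : ℂ) * ∏ l, (p l : ℂ) ^ N := by
  simp only [shiftMon, map_prod, map_pow, eval_X, hy, mon, Units.coe_prod,
    Units.val_zpow_eq_zpow_val]
  rw [← Finset.prod_mul_distrib]
  refine Finset.prod_congr rfl fun l _ => ?_
  rw [← zpow_natCast, Int.toNat_of_nonneg (ha l), zpow_add₀ (Units.ne_zero _), zpow_natCast]

variable {N}

theorem evalL_eq_zero_iff (hN : ∀ i, ∀ a ∈ A i, ∀ l, 0 ≤ a l + N)
    {i : Fin m} (f : {x // x ∈ A i} → ℂ) {p : Fin n → ℂˣ}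
    {y : Param a₀ → ℂ} (hy : ∀ l, y (Sum.inl l) = p l) :
    evalL f p = 0 ↔ ∑ a, f a * eval y (shiftMon N a₀ a.1) = 0 := by
  have hp : ∏ l, (p l : ℂ) ^ N ≠ 0 := Finset.prod_ne_zero_iff.2 fun l _ => by simp
  have : ∑ a, f a * eval y (shiftMon N a₀ a.1) = evalL f p * ∏ l, (p l : ℂ) ^ N := by
    rw [evalL, Finset.sum_mul]
    refine Finset.sum_congr rfl fun a _ => ?_
    rw [eval_shiftMon a₀ (hN i a.1 a.2) hy]
    ring
  rw [this, mul_eq_zero, or_iff_left hp]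

theorem evalL_param (hN : ∀ i, ∀ a ∈ A i, ∀ l, 0 ≤ a l + N)
    {p : Fin n → ℂˣ} {y : Param a₀ → ℂ} (hy : ∀ l, y (Sum.inl l) = p l)
    (i : Fin m) : evalL (fun a : {x // x ∈ A i} => eval y (param N a₀ ⟨i, a⟩)) p = 0 := by
  rw [evalL_eq_zero_iff a₀ hN _ hy, ← map_zero (eval y), ← sum_param_mul_shiftMon N a₀ i, map_sum]
  simp

theorem exists_eval_param_eq (hN : ∀ i, ∀ a ∈ A i, ∀ l, 0 ≤ a l + N)
    {f : ∀ i, {x // x ∈ A i} → ℂ} {p : Fin n → ℂˣ}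
    (hf : ∀ i, evalL (f i) p = 0) :
    ∃ y : Param a₀ → ℂ, (∀ l, y (Sum.inl l) = p l) ∧ ∀ v, eval y (param N a₀ v) = f v.1 v.2 := by
  let y : Param a₀ → ℂ := Sum.elim (fun l => p l) fun v =>
    f v.1.1 v.1.2 / ((mon p (a₀ v.1.1).1 : ℂ) * ∏ l, (p l : ℂ) ^ N)
  have hy : ∀ l, y (Sum.inl l) = p l := fun l => rfl
  have hM : ∀ i, eval y (shiftMon N a₀ (a₀ i).1) ≠ 0 := fun i => by
    rw [eval_shiftMon a₀ (hN i _ (a₀ i).2) hy]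
    exact mul_ne_zero (Units.ne_zero _) (Finset.prod_ne_zero_iff.2 fun l _ => by simp)
  have hc : ∀ v, eval y (freeCoeff a₀ v) = if v.2 = a₀ v.1 then 0 else
      f v.1 v.2 / eval y (shiftMon N a₀ (a₀ v.1).1) := by
    intro v
    rw [eval_shiftMon a₀ (hN v.1 _ (a₀ v.1).2) hy]
    by_cases h : v.2 = a₀ v.1 <;> simp [freeCoeff, h, y]
  refine ⟨y, hy, fun ⟨i, a⟩ => ?_⟩
  have h0 := (evalL_eq_zero_iff a₀ hN (f i) hy).1 (hf i)
  simp only [param, map_sub, map_mul, apply_ite (eval y), map_sum, map_zero, hc]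
  by_cases h : a = a₀ i
  · subst h
    rw [← Finset.add_sum_erase _ _ (Finset.mem_univ (a₀ i))] at h0 ⊢
    simp only [if_true, zero_mul, zero_add, zero_sub]
    rw [Finset.sum_congr rfl (g := fun a => f i a * eval y (shiftMon N a₀ a.1) /
      eval y (shiftMon N a₀ (a₀ i).1)), ← Finset.sum_div, neg_eq_iff_eq_neg, div_eq_iff (hM i)]
    · linear_combination h0
    · intro a ha
      rw [if_neg (Finset.ne_of_mem_erase ha)]
      ring
  · simp [h, hM]

theorem pderiv_inr_shiftMon (t : {v : CoeffIdx A // v.2 ≠ a₀ v.1}) (a : Fin n → ℤ) :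
    pderiv (Sum.inr t) (shiftMon N a₀ a) = 0 := by
  refine Finset.prod_induction _ (fun q => pderiv (Sum.inr t) q = 0) ?_ ?_ ?_
  · intro p q hp hq
    rw [pderiv_mul, hp, hq, zero_mul, mul_zero, add_zero]
  · simp
  · intro l _
    rw [pderiv_pow, pderiv_X_of_ne (by simp), mul_zero]

theorem pderiv_inr_freeCoeff (t : {v : CoeffIdx A // v.2 ≠ a₀ v.1}) (v : CoeffIdx A) :
    pderiv (Sum.inr t) (freeCoeff a₀ v) = if v = t.1 then 1 else 0 := by
  classical
  unfold freeCoeff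
  by_cases h : v.2 ≠ a₀ v.1
  · rw [dif_pos h, pderiv_X, Pi.single_apply]
    simp only [Sum.inr.injEq, Subtype.ext_iff, eq_comm]
  · rw [dif_neg h, map_zero, if_neg]
    rintro rfl
    exact h t.2

theorem pderiv_inr_param (t : {v : CoeffIdx A // v.2 ≠ a₀ v.1}) (v : CoeffIdx A) :
    pderiv (Sum.inr t) (param N a₀ v) = (if v = t.1 then shiftMon N a₀ (a₀ t.1.1).1 else 0) -
      if v = ⟨t.1.1, a₀ t.1.1⟩ then shiftMon N a₀ t.1.2.1 else 0 := by
  classical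
  have hprod : ∀ w a, pderiv (Sum.inr t) (freeCoeff a₀ w * shiftMon N a₀ a) =
      if w = t.1 then shiftMon N a₀ a else 0 := by
    intro w a
    rw [pderiv_mul, pderiv_inr_freeCoeff, pderiv_inr_shiftMon, mul_zero, add_zero, ite_mul, one_mul,
      zero_mul]
  obtain ⟨⟨i, a⟩, ht⟩ := t
  obtain ⟨j, b⟩ := v
  simp only [param, map_sub, hprod, apply_ite (pderiv _), map_sum, map_zero]
  by_cases hij : j = i
  · subst hij
    simp
  · simp [hij]

/-- The gradient of a relation among the coefficients of consistent systems is proportional to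
the vector of monomials at the common zero. -/
theorem aeval_pderiv_mul_shiftMon {R : MvPolynomial (CoeffIdx A) ℂ} (hR : aeval (param N a₀) R = 0)
    (i : Fin m) (a : {x // x ∈ A i}) :
    aeval (param N a₀) (pderiv ⟨i, a⟩ R) * shiftMon N a₀ (a₀ i).1 =
      aeval (param N a₀) (pderiv ⟨i, a₀ i⟩ R) * shiftMon N a₀ a.1 := by
  classical
  by_cases h : a = a₀ i
  · rw [h]
  have h1 := pderiv_aeval (param N a₀) R (Sum.inr ⟨⟨i, a⟩, h⟩)
  simp only [hR, map_zero, pderiv_inr_param, mul_sub, Finset.sum_sub_distrib, mul_ite, mul_zero,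
    Finset.sum_ite_eq', Finset.mem_univ, if_true] at h1
  exact (sub_eq_zero.1 h1.symm)

theorem dirDeriv_shiftMon (hN : ∀ i, ∀ a ∈ A i, ∀ l, 0 ≤ a l + N)
    {y : Param a₀ → ℂ} (hy : ∀ l, y (Sum.inl l) = 1) (u : Param a₀ → ℂ)
    {i : Fin m} (a : {x // x ∈ A i}) :
    dirDeriv y u (shiftMon N a₀ a.1) = ∑ l, ((a.1 l : ℂ) + N) * u (Sum.inl l) := by
  rw [shiftMon, dirDeriv_prod_of_eval_eq_one _ _ _ _ fun l _ => by simp [hy]]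
  refine Finset.sum_congr rfl fun l _ => ?_
  rw [dirDeriv_pow_of_eval_eq_one _ _ _ (by simp [hy]), dirDeriv_X]
  congr 1
  have := Int.toNat_of_nonneg (hN i a.1 a.2 l)
  exact_mod_cast congrArg (Int.cast : ℤ → ℂ) this

theorem dirDeriv_param (hN : ∀ i, ∀ a ∈ A i, ∀ l, 0 ≤ a l + N)
    {y : Param a₀ → ℂ} (hy : ∀ l, y (Sum.inl l) = 1) (u : Param a₀ → ℂ)
    (i : Fin m) (a : {x // x ∈ A i}) :
    dirDeriv y u (param N a₀ ⟨i, a⟩) = dirDeriv y u (freeCoeff a₀ ⟨i, a⟩) +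
        eval y (freeCoeff a₀ ⟨i, a⟩) * ∑ l, (((a₀ i).1 l : ℂ) + N) * u (Sum.inl l) -
      if a = a₀ i then ∑ b, (dirDeriv y u (freeCoeff a₀ ⟨i, b⟩) +
        eval y (freeCoeff a₀ ⟨i, b⟩) * ∑ l, ((b.1 l : ℂ) + N) * u (Sum.inl l)) else 0 := by
  have h1 : ∀ a, eval y (shiftMon N a₀ a) = 1 := fun a => by simp [shiftMon, hy]
  simp only [param, map_sub, apply_ite (dirDeriv y u), map_sum, map_zero, dirDeriv_mul, h1, mul_one,
    dirDeriv_shiftMon a₀ hN hy]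

theorem exists_relation (hN : ∀ i, ∀ a ∈ A i, ∀ l, 0 ≤ a l + N)
    {i : Fin m} {T : Fin n → Fin m} (hT : Function.Injective T)
    (hTi : ∀ k, T k ≠ i) (b : ∀ k, {x // x ∈ A (T k)})
    (hb : ∀ u : Fin n → ℂ, (∀ k, ∑ l, (((b k).1 l : ℂ) - (a₀ (T k)).1 l) * u l = 0) → u = 0) :
    ∃ R : MvPolynomial (CoeffIdx A) ℂ, aeval (param N a₀) R = 0 ∧
      aeval (param N a₀) (pderiv ⟨i, a₀ i⟩ R) ≠ 0 := by
  classical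
  let e : Option (Param a₀) → CoeffIdx A := fun s =>
    s.elim ⟨i, a₀ i⟩ (Sum.elim (fun k => ⟨T k, a₀ (T k)⟩) fun v => v.1)
  have he : Function.Injective e := by
    have hbase : ∀ (j : Fin m) (v : {v : CoeffIdx A // v.2 ≠ a₀ v.1}),
        (⟨j, a₀ j⟩ : CoeffIdx A) ≠ v.1 := by
      rintro j ⟨v, hv⟩ rfl
      exact hv rfl
    rintro (_ | k | v) (_ | k' | v') h
    · rfl
    · exact absurd (congrArg Sigma.fst h).symm (hTi k')
    · exact absurd h (hbase _ _)
    · exact absurd (congrArg Sigma.fst h) (hTi k)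
    · rw [hT (congrArg Sigma.fst h)]
    · exact absurd h (hbase _ _)
    · exact absurd h.symm (hbase _ _)
    · exact absurd h.symm (hbase _ _)
    · rw [Subtype.ext h]
  let y : Param a₀ → ℂ := Sum.elim (fun _ => 1) fun v => if ∃ k, v.1 = ⟨T k, b k⟩ then 1 else 0
  have hy : ∀ l, y (Sum.inl l) = 1 := fun _ => rfl
  have key := exists_relation_pderiv_none_ne_zero (param N a₀ ∘ e) y fun u hu => ?_
  · obtain ⟨P, hP, hP'⟩ := key
    refine ⟨rename e P, by rw [aeval_rename, hP], ?_⟩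
    have : (⟨i, a₀ i⟩ : CoeffIdx A) = e none := rfl
    rwa [this, pderiv_rename he, aeval_rename]
  simp only [← dirDeriv_apply] at hu
  have hfree : ∀ v, dirDeriv y u (freeCoeff a₀ v) =
      -(eval y (freeCoeff a₀ v) * ∑ l, (((a₀ v.1).1 l : ℂ) + N) * u (Sum.inl l)) := by
    intro v
    by_cases hv : v.2 = a₀ v.1
    · simp [freeCoeff, hv]
    · have := hu (Sum.inr ⟨v, hv⟩)
      simp only [Function.comp_apply, e, Option.elim_some, Sum.elim_inr] at this
      rw [dirDeriv_param a₀ hN hy u v.1 v.2, if_neg hv, sub_zero] at this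
      exact eq_neg_of_add_eq_zero_left this
  have hinl : ∀ l, u (Sum.inl l) = 0 := by
    refine congrFun (hb (fun l => u (Sum.inl l)) fun k => ?_)
    have h1 := hu (Sum.inl k)
    simp only [Function.comp_apply, e, Option.elim_some, Sum.elim_inl] at h1
    rw [dirDeriv_param a₀ hN hy u (T k) (a₀ (T k)), if_pos rfl, hfree, neg_add_cancel, zero_sub,
      neg_eq_zero] at h1
    simp only [hfree] at h1
    by_cases hbk : b k = a₀ (T k)
    · simp [hbk]
    rw [Finset.sum_eq_single (b k)] at h1
    · have h2 : eval y (freeCoeff a₀ ⟨T k, b k⟩) = 1 := by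
        have h3 : ∃ k', (⟨T k, b k⟩ : CoeffIdx A) = ⟨T k', b k'⟩ := ⟨k, rfl⟩
        rw [freeCoeff, dif_pos hbk, eval_X]
        exact if_pos h3
      rw [h2, one_mul, one_mul, neg_add_eq_zero] at h1
      simp only [add_mul, sub_mul, Finset.sum_add_distrib, Finset.sum_sub_distrib] at h1 ⊢
      linear_combination -h1
    · intro a _ ha
      have h2 : eval y (freeCoeff a₀ ⟨T k, a⟩) = 0 := by
        unfold freeCoeff
        split_ifs with h
        · rw [eval_X]
          refine if_neg ?_
          rintro ⟨k', hk'⟩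
          obtain rfl := hT (congrArg Sigma.fst hk')
          exact ha (eq_of_heq (Sigma.mk.inj hk').2)
        · exact map_zero _
      rw [h2]
      simp
    · simp
  funext s
  rcases s with l | v
  · exact hinl l
  · have := hfree v.1
    rw [freeCoeff, dif_pos v.2, dirDeriv_X] at this
    simpa [hinl] using this


/-- A choice of `n` equations, avoiding a given one, and one further support point in each of them
such that the differences to the distinguished support points are linearly independent. -/
theorem exists_independent_differences {n d : ℕ} {A : Fin (n + d) → Finset (Fin n → ℤ)}
    (hess : ∀ J : Finset (Fin (n + d)), J ⊂ Finset.univ →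
      -(d : ℤ) < colDefect (fun i => realize (A i)) J)
    (a₀ : ∀ i, {x // x ∈ A i}) (i : Fin (n + d)) :
    ∃ T : Fin n → Fin (n + d), Function.Injective T ∧ (∀ k, T k ≠ i) ∧
      ∃ b : ∀ k, {x // x ∈ A (T k)}, ∀ u : Fin n → ℂ,
        (∀ k, ∑ l, (((b k).1 l : ℂ) - (a₀ (T k)).1 l) * u l = 0) → u = 0 := by
  classical
  let B : Fin (n + d) → Finset (Fin n → ℝ) := fun j =>
    (A j).image fun a l => (a l : ℝ) - (a₀ j).1 l
  have hspan : ∀ J : Finset (Fin (n + d)), colSpan (fun i => realize (A i)) (J : Set (Fin (n + d))) ≤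
      Submodule.span ℝ (⋃ j ∈ J, (B j : Set (Fin n → ℝ))) := by
    intro J
    refine Submodule.span_le.2 ?_
    rintro _ ⟨j, hj, _, ⟨a, ha, rfl⟩, _, ⟨b, hb, rfl⟩, rfl⟩
    have hmem : ∀ a ∈ A j, (fun l => (a l : ℝ) - (a₀ j).1 l) ∈
        Submodule.span ℝ (⋃ j ∈ J, (B j : Set (Fin n → ℝ))) := fun a ha =>
      Submodule.subset_span (Set.mem_biUnion hj (Finset.mem_coe.2 (Finset.mem_image_of_mem _ ha)))
    convert! Submodule.sub_mem _ (hmem a ha) (hmem b hb) using 1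
    ext l
    simp
  obtain ⟨b, hb, hrank⟩ := exists_transversal_le_finrank_span (K := ℝ) (Finset.univ.erase i)
    ((d : ℤ) - 1) B (fun j => ⟨_, Finset.mem_image_of_mem _ (a₀ j).2⟩) (by
      intro J hJ
      have h1 := hess J (lt_of_le_of_lt hJ (Finset.erase_ssubset (Finset.mem_univ i)))
      have h2 := Submodule.finrank_mono (hspan J)
      unfold colDefect at h1
      omega)
  rw [Finset.card_erase_of_mem (Finset.mem_univ i), Finset.card_univ, Fintype.card_fin] at hrank
  have hpos : 0 < n + d := i.pos
  have hrank' : Module.finrank ℝ (Submodule.span ℝ (b '' (Finset.univ.erase i : Finset _))) = n := by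
    refine le_antisymm ((Submodule.finrank_le _).trans (by simp)) ?_
    omega
  obtain ⟨g, hg, -, hli⟩ := Submodule.exists_fun_fin_finrank_span_eq ℝ
    (b '' (Finset.univ.erase i : Finset (Fin (n + d))))
  let σ : Fin n → Fin _ := Fin.cast hrank'.symm
  have hσ : Function.Injective σ := Fin.cast_injective _
  replace hli := hli.comp σ hσ
  choose T hT hTg using fun k => hg (σ k)
  choose c hcA hc using fun j => Finset.mem_image.1 (hb j)
  have hgk : ∀ k l, g (σ k) l = (c (T k) l : ℝ) - (a₀ (T k)).1 l := fun k l => by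
    rw [← hTg, ← hc]
  refine ⟨T, fun k k' h => hli.injective ?_, fun k => Finset.ne_of_mem_erase (hT k),
    fun k => ⟨c (T k), hcA _⟩, fun u hu => ?_⟩
  · rw [Function.comp_apply, Function.comp_apply, ← hTg, ← hTg, h]
  let M : Matrix (Fin n) (Fin n) ℤ := Matrix.of fun k l => c (T k) l - (a₀ (T k)).1 l
  have hM : M.det ≠ 0 := by
    intro h0
    have h1 : (M.map (Int.castRingHom ℝ)).det = 0 := by
      rw [← RingHom.mapMatrix_apply, ← RingHom.map_det, h0, map_zero]
    have h2 : IsUnit (M.map (Int.castRingHom ℝ)) := by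
      rw [← Matrix.linearIndependent_rows_iff_isUnit]
      have hrow : (M.map (Int.castRingHom ℝ)).row = g ∘ σ := by
        ext k l
        simp [M, hgk, Matrix.row]
      rwa [hrow]
    exact ((Matrix.isUnit_iff_isUnit_det _).1 h2).ne_zero h1
  refine Matrix.eq_zero_of_mulVec_eq_zero (M := M.map (Int.castRingHom ℂ)) ?_ (funext fun k => ?_)
  · rw [← RingHom.mapMatrix_apply, ← RingHom.map_det]
    simpa using hM
  · rw [Pi.zero_apply, ← hu k]
    simp [Matrix.mulVec, dotProduct, M]

end ConsistentSystem

open MvPolynomial ConsistentSystem in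
/-- If `A = (A_1, …, A_{n+d})` is an essential collection of defect `−d`
(`d ≥ 1`) with `G(A) = ℤ^n` (i.e. `ind(A) = 1`), then for a generic consistent system (a system
in `X_A` outside the zero set of a polynomial `F` not vanishing identically on `X_A`) the zero
set `Y_f` is a single point. -/
theorem generic_consistent_single_point {n d : ℕ} (hn : 1 ≤ n) (hd : 1 ≤ d)
    (A : Fin (n + d) → Finset (Fin n → ℤ)) (hA : ∀ i, (A i).Nonempty)
    (hG : AddSubgroup.closure
        {v : Fin n → ℤ | ∃ i, ∃ a ∈ A i, ∃ b ∈ A i, v = a - b} = ⊤)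
    (hmin : colMinDefectOn (fun i => realize (A i)) Finset.univ = -(d : ℤ))
    (hdef : colDefect (fun i => realize (A i)) Finset.univ = -(d : ℤ))
    (hess : ∀ J : Finset (Fin (n + d)), J ⊂ Finset.univ →
      -(d : ℤ) < colDefect (fun i => realize (A i)) J) :
    ∃ F : MvPolynomial ((i : Fin (n + d)) × {x // x ∈ A i}) ℂ,
      (∃ f : ∀ i, {x // x ∈ A i} → ℂ, (∃ p : Fin n → ℂˣ, ∀ i, evalL (f i) p = 0) ∧
        MvPolynomial.eval (fun v => f v.1 v.2) F ≠ 0) ∧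
      ∀ f : ∀ i, {x // x ∈ A i} → ℂ,
        (∃ p : Fin n → ℂˣ, ∀ i, evalL (f i) p = 0) →
        MvPolynomial.eval (fun v => f v.1 v.2) F ≠ 0 →
        ∃! p : Fin n → ℂˣ, ∀ i, evalL (f i) p = 0 := by
  classical
  choose a₀' ha₀' using hA
  let a₀ : ∀ i, {x // x ∈ A i} := fun i => ⟨a₀' i, ha₀' i⟩
  obtain ⟨N, hN⟩ : ∃ N : ℕ, ∀ i, ∀ a ∈ A i, ∀ l, 0 ≤ a l + N := by
    refine ⟨∑ i, ∑ a ∈ A i, ∑ l, (a l).natAbs, fun i a ha l => ?_⟩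
    have h1 : (a l).natAbs ≤ ∑ l, (a l).natAbs :=
      Finset.single_le_sum (f := fun l => (a l).natAbs) (fun _ _ => Nat.zero_le _)
        (Finset.mem_univ l)
    have h2 : ∑ l, (a l).natAbs ≤ ∑ a ∈ A i, ∑ l, (a l).natAbs :=
      Finset.single_le_sum (f := fun a : Fin n → ℤ => ∑ l, (a l).natAbs)
        (fun _ _ => Nat.zero_le _) ha
    have h3 : ∑ a ∈ A i, ∑ l, (a l).natAbs ≤ ∑ i, ∑ a ∈ A i, ∑ l, (a l).natAbs :=
      Finset.single_le_sum (f := fun i => ∑ a ∈ A i, ∑ l, (a l).natAbs)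
        (fun _ _ => Nat.zero_le _) (Finset.mem_univ i)
    omega
  have hrel : ∀ i, ∃ R : MvPolynomial (CoeffIdx A) ℂ, aeval (param N a₀) R = 0 ∧
      aeval (param N a₀) (pderiv ⟨i, a₀ i⟩ R) ≠ 0 := by
    intro i
    obtain ⟨T, hT, hTi, b, hb⟩ := exists_independent_differences hess a₀ i
    exact exists_relation a₀ hN hT hTi b hb
  choose R hR hR' using hrel
  have heval : ∀ (y : Param a₀ → ℂ) (Q : MvPolynomial (CoeffIdx A) ℂ),
      eval y (aeval (param N a₀) Q) = eval (fun v => eval y (param N a₀ v)) Q := by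
    intro y Q
    simp only [← coe_aeval_eq_eval, RingHom.coe_coe]
    exact comp_aeval_apply _ (aeval y) Q
  refine ⟨∏ i, pderiv ⟨i, a₀ i⟩ (R i), ?_, ?_⟩
  · have hne : aeval (param N a₀) (∏ i, pderiv ⟨i, a₀ i⟩ (R i)) * ∏ l, X (Sum.inl l) ≠ 0 := by
      rw [map_prod]
      exact mul_ne_zero (Finset.prod_ne_zero_iff.2 fun i _ => hR' i)
        (Finset.prod_ne_zero_iff.2 fun l _ => X_ne_zero _)
    obtain ⟨y, hy⟩ : ∃ y, eval y (aeval (param N a₀) (∏ i, pderiv ⟨i, a₀ i⟩ (R i)) *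
        ∏ l, X (Sum.inl l)) ≠ 0 := by
      by_contra! h
      exact hne (MvPolynomial.funext fun y => by rw [h y, map_zero])
    rw [map_mul, heval] at hy
    have hl : ∀ l, y (Sum.inl l) ≠ 0 := by
      have := right_ne_zero_of_mul hy
      rw [map_prod, Finset.prod_ne_zero_iff] at this
      exact fun l => by simpa using this l (Finset.mem_univ l)
    exact ⟨fun i a => eval y (param N a₀ ⟨i, a⟩),
      ⟨fun l => Units.mk0 _ (hl l), evalL_param a₀ hN fun l => rfl⟩, left_ne_zero_of_mul hy⟩
  · rintro f ⟨p, hp⟩ hf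
    have hgrad : ∀ q : Fin n → ℂˣ, (∀ i, evalL (f i) q = 0) → ∀ i (a : {x // x ∈ A i}),
        ((mon q a.1 / mon q (a₀ i).1 : ℂˣ) : ℂ) = eval (fun v => f v.1 v.2) (pderiv ⟨i, a⟩ (R i)) /
          eval (fun v => f v.1 v.2) (pderiv ⟨i, a₀ i⟩ (R i)) := by
      intro q hq i a
      obtain ⟨y, hyq, hyf⟩ := exists_eval_param_eq a₀ hN hq
      have h1 := congrArg (eval y) (aeval_pderiv_mul_shiftMon a₀ (hR i) i a)
      have h2 : eval (fun v => f v.1 v.2) (pderiv ⟨i, a₀ i⟩ (R i)) ≠ 0 := by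
        rw [map_prod, Finset.prod_ne_zero_iff] at hf
        exact hf i (Finset.mem_univ i)
      have h3 : ∏ l, (q l : ℂ) ^ N ≠ 0 := Finset.prod_ne_zero_iff.2 fun l _ => by simp
      rw [map_mul, map_mul, heval, heval, _root_.funext hyf,
        eval_shiftMon a₀ (hN i _ (a₀ i).2) hyq, eval_shiftMon a₀ (hN i _ a.2) hyq, ← mul_assoc,
        ← mul_assoc] at h1
      rw [Units.val_div_eq_div_val, div_eq_div_iff (Units.ne_zero _) h2]
      linear_combination -mul_right_cancel₀ h3 h1
    refine ⟨p, hp, fun q hq => eq_of_mon_eq hG ?_⟩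
    rintro _ ⟨i, a, ha, b, hb, rfl⟩
    have hquot : ∀ a : {x // x ∈ A i}, mon q a.1 / mon q (a₀ i).1 = mon p a.1 / mon p (a₀ i).1 :=
      fun a => Units.ext ((hgrad q hq i a).trans (hgrad p hp i a).symm)
    rw [mon_sub, mon_sub, ← div_div_div_cancel_right _ _ (mon q (a₀ i).1), hquot ⟨a, ha⟩,
      hquot ⟨b, hb⟩, div_div_div_cancel_right]
end
end
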